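/- Let N ≥ 2, 0 ≤ m ≤ N−2, and assume t ≠ 0 and [n]_t ≠ 0 for 1 ≤ n ≤ m+1. For N−m−1 ≤ i ≤ N set π_i := φ_{{N−m−1,…,N}∖{i}} ∈ P. Then (T_{N−m−1} − t)(T_{N−m} − κ_2)(T_{N−m+1} − κ_3)⋯(T_{N−1} − κ_{m+1}) π_N = t^{m−N+2} · D(φ_{{N−m−1,…,N}}), where the operator product is composed so that the rightmost factor (T_{N−1} − κ_{m+1}) acts first. Consequently, since D commutes with each T_i and D² = 0, the operator (T_{N−m−1} − t)(T_{N−m} − κ_2)⋯(T_{N−1} − κ_{m+1}) annihilates D(π_N). -/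

import Mathlib

open Finset

noncomputable def phi (K : Type*) [Field K] (E : Finset ℕ) : Finset ℕ →₀ K :=
  Finsupp.single E 1

noncomputable def Tgen {K : Type*} [Field K] (t : K) (i : ℕ) :
    (Finset ℕ →₀ K) →ₗ[K] (Finset ℕ →₀ K) :=
  Finsupp.lift _ K _ fun E =>
    if i ∈ E then
      if i + 1 ∈ E then -(phi K E)
      else phi K (insert (i + 1) (E.erase i))
    else
      if i + 1 ∈ E then t • phi K (insert i (E.erase (i + 1))) + (t - 1) • phi K E
      else t • phi K E

def sgn (i : ℕ) (E : Finset ℕ) : ℕ := (E.filter (· < i)).card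

noncomputable def Mop (K : Type*) [Field K] (N : ℕ) :
    (Finset ℕ →₀ K) →ₗ[K] (Finset ℕ →₀ K) :=
  Finsupp.lift _ K _ fun E =>
    ∑ i ∈ (Finset.Icc 1 N) \ E, ((-1 : K) ^ sgn i E) • phi K (insert i E)

noncomputable def Dop {K : Type*} [Field K] (t : K) :
    (Finset ℕ →₀ K) →ₗ[K] (Finset ℕ →₀ K) :=
  Finsupp.lift _ K _ fun E =>
    ∑ i ∈ E, ((-1 : K) ^ sgn i E * t ^ (i - 1)) • phi K (E.erase i)

noncomputable def qint {K : Type*} [Field K] (t : K) (n : ℕ) : K :=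
  ∑ i ∈ Finset.range n, t ^ i

noncomputable def kappa {K : Type*} [Field K] (t : K) (n : ℤ) : K :=
  if 0 < n then t ^ n.toNat / qint t n.toNat else -(1 / qint t (-n).toNat)

section Operators

variable {K : Type*} [Field K] (t : K)

lemma Dop_phi (E : Finset ℕ) :
    Dop t (phi K E) = ∑ i ∈ E, ((-1 : K) ^ sgn i E * t ^ (i - 1)) • phi K (E.erase i) := by
  simp [Dop, phi]

lemma Tgen_phi (i : ℕ) (E : Finset ℕ) : Tgen t i (phi K E) =
    if i ∈ E then
      if i + 1 ∈ E then -(phi K E)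
      else phi K (insert (i + 1) (E.erase i))
    else
      if i + 1 ∈ E then t • phi K (insert i (E.erase (i + 1))) + (t - 1) • phi K E
      else t • phi K E := by
  rw [Tgen, Finsupp.lift_apply]
  conv_lhs => rw [phi]
  rw [Finsupp.sum_single_index, one_smul]
  exact zero_smul K _

lemma Tgen_phi_of_mem_of_mem {i : ℕ} {E : Finset ℕ} (h : i ∈ E) (h' : i + 1 ∈ E) :
    Tgen t i (phi K E) = -phi K E := by
  simp [Tgen_phi, h, h']

lemma Tgen_phi_of_notMem_of_notMem {i : ℕ} {E : Finset ℕ} (h : i ∉ E) (h' : i + 1 ∉ E) :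
    Tgen t i (phi K E) = t • phi K E := by
  simp [Tgen_phi, h, h']

lemma Tgen_phi_insert {i : ℕ} {F : Finset ℕ} (h : i ∉ F) (h' : i + 1 ∉ F) :
    Tgen t i (phi K (insert i F)) = phi K (insert (i + 1) F) := by
  simp [Tgen_phi, h, h']

lemma Tgen_phi_insert_succ {i : ℕ} {F : Finset ℕ} (h : i ∉ F) (h' : i + 1 ∉ F) :
    Tgen t i (phi K (insert (i + 1) F)) =
      t • phi K (insert i F) + (t - 1) • phi K (insert (i + 1) F) := by
  simp [Tgen_phi, h, h']

lemma sgn_insert {i x : ℕ} {F : Finset ℕ} (hx : x ∉ F) :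
    sgn i (insert x F) = sgn i F + if x < i then 1 else 0 := by
  unfold sgn
  rw [filter_insert]
  split_ifs <;> simp [hx]

lemma Dop_phi_insert {x : ℕ} {F : Finset ℕ} (hx : x ∉ F) :
    Dop t (phi K (insert x F)) = ((-1 : K) ^ sgn x F * t ^ (x - 1)) • phi K F +
      ∑ j ∈ F, ((if x < j then -1 else 1) * ((-1 : K) ^ sgn j F * t ^ (j - 1))) •
        phi K (insert x (F.erase j)) := by
  rw [Dop_phi, sum_insert hx, sgn_insert hx, erase_insert hx]
  congr 1
  · simp
  · refine sum_congr rfl fun j hj => ?_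
    have hne : x ≠ j := fun h => hx (h ▸ hj)
    rw [sgn_insert hx, erase_insert_of_ne hne]
    congr 1
    split_ifs <;> simp [pow_succ]

lemma sgn_succ_of_notMem {i : ℕ} {F : Finset ℕ} (h : i ∉ F) : sgn (i + 1) F = sgn i F := by
  unfold sgn
  congr 1
  refine filter_congr fun j hj => ?_
  have : j ≠ i := fun e => h (e ▸ hj)
  omega

lemma Dop_phi_insert_insert_succ {i : ℕ} {F : Finset ℕ} (h : i ∉ F) (h' : i + 1 ∉ F) :
    Dop t (phi K (insert i (insert (i + 1) F))) =
      ((-1 : K) ^ sgn i F * t ^ (i - 1)) • phi K (insert (i + 1) F)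
      - ((-1 : K) ^ sgn i F * t ^ i) • phi K (insert i F)
      + ∑ j ∈ F, ((-1 : K) ^ sgn j F * t ^ (j - 1)) •
        phi K (insert i (insert (i + 1) (F.erase j))) := by
  have hi : i ∉ insert (i + 1) F := by simp [h]
  rw [Dop_phi_insert t hi, sum_insert h', sgn_insert h', sgn_insert h', erase_insert h',
    sgn_succ_of_notMem h]
  have hsum : ∀ j ∈ F, ((if i < j then -1 else 1) *
      ((-1 : K) ^ sgn j (insert (i + 1) F) * t ^ (j - 1))) •
        phi K (insert i ((insert (i + 1) F).erase j)) =
      ((-1 : K) ^ sgn j F * t ^ (j - 1)) • phi K (insert i (insert (i + 1) (F.erase j))) := by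
    intro j hj
    have h1 : i ≠ j := fun e => h (e ▸ hj)
    have h2 : i + 1 ≠ j := fun e => h' (e ▸ hj)
    rw [erase_insert_of_ne h2, sgn_insert h']
    congr 1
    by_cases hlt : i < j
    · have : i + 1 < j := by omega
      simp [hlt, this, pow_succ]
    · have : ¬ i + 1 < j := by omega
      simp [hlt, this]
  rw [sum_congr rfl hsum]
  simp
  abel

lemma exists_base_set (i : ℕ) (E : Finset ℕ) : ∃ F : Finset ℕ, i ∉ F ∧ i + 1 ∉ F ∧
    (E = F ∨ E = insert i F ∨ E = insert (i + 1) F ∨ E = insert i (insert (i + 1) F)) := by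
  refine ⟨(E.erase i).erase (i + 1), by simp, by simp, ?_⟩
  by_cases h : i ∈ E <;> by_cases h' : i + 1 ∈ E
  · right; right; right; ext x; simp; grind
  · right; left; ext x; simp; grind
  · right; right; left; ext x; simp; grind
  · left; ext x; simp; grind

theorem Tgen_Dop_phi {i : ℕ} (hi : 1 ≤ i) (E : Finset ℕ) :
    Tgen t i (Dop t (phi K E)) = Dop t (Tgen t i (phi K E)) := by
  obtain ⟨F, h, h', hE⟩ := exists_base_set i E
  have g : ∀ j, i ∉ F.erase j := fun j hj => h (mem_of_mem_erase hj)
  have g' : ∀ j, i + 1 ∉ F.erase j := fun j hj => h' (mem_of_mem_erase hj)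
  have hpow : t ^ i = t * t ^ (i - 1) := by
    rw [← pow_succ']
    congr 1
    omega
  have hsign : ∀ j ∈ F, (if i + 1 < j then -1 else 1 : K) = if i < j then -1 else 1 := by
    intro j hj
    have : i + 1 ≠ j := fun e => h' (e ▸ hj)
    have : i + 1 < j ↔ i < j := by omega
    simp [this]
  have hsucc : Dop t (phi K (insert (i + 1) F)) = ((-1 : K) ^ sgn i F * t ^ i) • phi K F +
      ∑ j ∈ F, ((if i < j then -1 else 1) * ((-1 : K) ^ sgn j F * t ^ (j - 1))) •
        phi K (insert (i + 1) (F.erase j)) := by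
    rw [Dop_phi_insert t h', sgn_succ_of_notMem h, Nat.add_sub_cancel]
    congr 1
    exact sum_congr rfl fun j hj => by rw [hsign j hj]
  rcases hE with rfl | rfl | rfl | rfl
  · rw [Tgen_phi_of_notMem_of_notMem t h h', map_smul, Dop_phi, map_sum, smul_sum]
    refine sum_congr rfl fun j _ => ?_
    rw [map_smul, Tgen_phi_of_notMem_of_notMem t (g j) (g' j), smul_comm]
  · rw [Tgen_phi_insert t h h', Dop_phi_insert t h, hsucc, map_add, map_smul, map_sum,
      Tgen_phi_of_notMem_of_notMem t h h', hpow]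
    congr 1
    · module
    · refine sum_congr rfl fun j _ => ?_
      rw [map_smul, Tgen_phi_insert t (g j) (g' j)]
  · rw [Tgen_phi_insert_succ t h h', map_add, map_smul, map_smul, Dop_phi_insert t h, hsucc,
      map_add, map_smul, map_sum, Tgen_phi_of_notMem_of_notMem t h h', hpow]
    simp only [map_smul, Tgen_phi_insert_succ t (g _) (g' _), smul_add, sum_add_distrib, smul_sum]
    simp only [smul_comm _ t, smul_comm _ (t - 1)]
    module
  · rw [Tgen_phi_of_mem_of_mem t (by simp) (by simp), map_neg,
      Dop_phi_insert_insert_succ t h h', map_add, map_sub, map_smul, map_smul, map_sum,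
      Tgen_phi_insert_succ t h h', Tgen_phi_insert t h h', hpow]
    simp only [map_smul, Tgen_phi_of_mem_of_mem t (mem_insert_self i _)
      (mem_insert_of_mem (mem_insert_self (i + 1) _)), smul_neg, sum_neg_distrib]
    module

theorem commute_Tgen_Dop {i : ℕ} (hi : 1 ≤ i) :
    Commute (Tgen t i : Module.End K (Finset ℕ →₀ K)) (Dop t) := by
  refine Finsupp.lhom_ext' fun E => LinearMap.ext_ring ?_
  exact Tgen_Dop_phi t hi E

lemma sgn_erase_of_lt {i j : ℕ} {E : Finset ℕ} (hi : i ∈ E) (hij : i < j) :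
    sgn j E = sgn j (E.erase i) + 1 := by
  conv_lhs => rw [← insert_erase hi]
  rw [sgn_insert (notMem_erase i E), if_pos hij]

lemma sgn_erase_of_le {i j : ℕ} {E : Finset ℕ} (hij : j ≤ i) :
    sgn j (E.erase i) = sgn j E := by
  unfold sgn
  rw [filter_erase, erase_eq_of_notMem]
  simp [hij]

theorem Dop_Dop_phi (E : Finset ℕ) : Dop t (Dop t (phi K E)) = 0 := by
  rw [Dop_phi, map_sum]
  simp only [map_smul, Dop_phi, smul_sum]
  rw [sum_sigma']
  refine sum_involution (fun p _ => ⟨p.2, p.1⟩) ?_ ?_ ?_ ?_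
  · rintro ⟨i, j⟩ hp
    simp only [mem_sigma, mem_erase] at hp
    obtain ⟨hi, hji, hj⟩ := hp
    simp only [smul_smul]
    rw [erase_right_comm (a := j), ← add_smul]
    convert zero_smul K _
    rcases lt_or_gt_of_ne hji with hlt | hlt
    · rw [sgn_erase_of_le hlt.le, sgn_erase_of_lt hj hlt]
      ring
    · rw [sgn_erase_of_le hlt.le, sgn_erase_of_lt hi hlt]
      ring
  · rintro ⟨i, j⟩ hp _ heq
    simp only [mem_sigma, mem_erase] at hp
    simp only [Sigma.mk.injEq] at heq
    exact hp.2.1 heq.1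
  · rintro ⟨i, j⟩ hp
    simp only [mem_sigma, mem_erase] at hp ⊢
    exact ⟨hp.2.2, hp.2.1.symm, hp.1⟩
  · simp

lemma kappa_natCast {n : ℕ} (hn : 0 < n) : kappa t n = t ^ n / qint t n := by
  simp [kappa, hn]

lemma qint_succ (n : ℕ) : qint t (n + 1) = qint t n + t ^ n := sum_range_succ _ _

lemma Tgen_phi_erase_succ {A : Finset ℕ} {c : ℕ} (hc : c ∈ A) (hc' : c + 1 ∈ A) :
    Tgen t c (phi K (A.erase (c + 1))) = phi K (A.erase c) := by
  have h1 : A.erase (c + 1) = insert c ((A.erase c).erase (c + 1)) := by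
    ext x; simp; grind
  have h2 : A.erase c = insert (c + 1) ((A.erase c).erase (c + 1)) := by
    ext x; simp; grind
  rw [h1, Tgen_phi_insert t (by simp) (by simp), ← h2]

lemma Tgen_phi_erase_of_succ_lt {A : Finset ℕ} {c j : ℕ} (hc : c ∈ A) (hc' : c + 1 ∈ A)
    (hj : c + 1 < j) : Tgen t c (phi K (A.erase j)) = -phi K (A.erase j) :=
  Tgen_phi_of_mem_of_mem t (mem_erase.2 ⟨by omega, hc⟩) (mem_erase.2 ⟨by omega, hc'⟩)

/-- With `π_i = φ_{A∖{i}}`, the vector `π_c - κ_n ∑_{j < L} (-t)^j π_{c+1+j}`. -/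
noncomputable def chainVec (A : Finset ℕ) (c L n : ℕ) : Finset ℕ →₀ K :=
  phi K (A.erase c) -
    (t ^ n / qint t n) • ∑ j ∈ range L, (-t) ^ j • phi K (A.erase (c + 1 + j))

lemma Tgen_sub_kappa_chainVec {A : Finset ℕ} {c L n : ℕ} (hc : c ∈ A) (hc' : c + 1 ∈ A)
    (hn : 0 < n) (hq : qint t n ≠ 0) (hq' : qint t (n + 1) ≠ 0 ∨ L = 0) :
    ((Tgen t c : Module.End K (Finset ℕ →₀ K)) - kappa t n • 1) (chainVec t A (c + 1) L (n + 1))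
      = chainVec t A c (L + 1) n := by
  have hT : Tgen t c (∑ j ∈ range L, (-t) ^ j • phi K (A.erase (c + 1 + 1 + j))) =
      -∑ j ∈ range L, (-t) ^ j • phi K (A.erase (c + 1 + 1 + j)) := by
    rw [map_sum, ← sum_neg_distrib]
    refine sum_congr rfl fun j _ => ?_
    rw [map_smul, Tgen_phi_erase_of_succ_lt t hc hc' (by omega), smul_neg]
  have hS : ∑ j ∈ range (L + 1), (-t) ^ j • phi K (A.erase (c + 1 + j)) =
      phi K (A.erase (c + 1)) +
        (-t) • ∑ j ∈ range L, (-t) ^ j • phi K (A.erase (c + 1 + 1 + j)) := by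
    rw [sum_range_succ', add_comm, smul_sum]
    congr 1
    · simp
    · refine sum_congr rfl fun j _ => ?_
      rw [smul_smul, ← pow_succ', add_assoc (c + 1) 1 j, add_comm 1 j]
  unfold chainVec
  rw [hS, kappa_natCast t hn, LinearMap.sub_apply, LinearMap.smul_apply, Module.End.one_apply,
    map_sub, map_smul, hT, Tgen_phi_erase_succ t hc hc']
  rcases hq' with hq' | rfl
  · have key : t ^ (n + 1) / qint t (n + 1) * (1 + t ^ n / qint t n) = t ^ n / qint t n * t := by
      field_simp
      rw [qint_succ]
      ring
    linear_combination (norm := module) key • ∑ j ∈ range L, (-t) ^ j • phi K (A.erase (c + 1 + 1 + j))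
  · simp

lemma prod_Tgen_sub_kappa_chainVec {a N k L : ℕ} (hk : a + 1 + k ≤ N)
    (hq : ∀ n : ℕ, 1 ≤ n → n ≤ k + 1 → qint t n ≠ 0) (hq' : qint t (k + 2) ≠ 0 ∨ L = 0) :
    ((List.range k).map fun j =>
        (Tgen t (a + 1 + j) : Module.End K (Finset ℕ →₀ K)) - kappa t ((j : ℤ) + 2) • 1).prod
      (chainVec t (Icc a N) (a + 1 + k) L (k + 2)) =
      chainVec t (Icc a N) (a + 1) (L + k) 2 := by
  induction k generalizing L with
  | zero => simp
  | succ k ih =>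
    have hstep := Tgen_sub_kappa_chainVec t (A := Icc a N) (c := a + 1 + k) (L := L) (n := k + 2)
      (by simp; omega) (by simp; omega) (by omega) (hq _ (by omega) (by omega)) hq'
    push_cast at hstep
    rw [List.range_succ, List.map_append, List.prod_append, List.map_singleton,
      List.prod_singleton, Module.End.mul_apply]
    refine (congrArg _ hstep).trans ?_
    rw [ih (by omega) (fun n h1 h2 => hq n h1 (by omega)) (Or.inl (hq _ (by omega) (by omega)))]
    congr 1
    omega

lemma chainVec_one_eq (ht0 : t ≠ 0) {a : ℕ} (ha : 1 ≤ a) (L : ℕ) :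
    chainVec t (Icc a (a + L)) a L 1 =
      t ^ (1 - (a : ℤ)) • Dop t (phi K (Icc a (a + L))) := by
  have hsgn : ∀ j ∈ range (L + 1), sgn (a + j) (Icc a (a + L)) = j := by
    intro j hj
    have : (Icc a (a + L)).filter (· < a + j) = Ico a (a + j) := by
      ext x
      simp at hj ⊢
      omega
    rw [sgn, this]
    simp
  have hIcc : Icc a (a + L) = (range (L + 1)).map (addLeftEmbedding a) := by
    ext x
    simp only [mem_Icc, mem_map, mem_range, addLeftEmbedding_apply]
    exact ⟨fun h => ⟨x - a, by omega, by omega⟩, by rintro ⟨j, hj, rfl⟩; omega⟩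
  have hD : t ^ (1 - (a : ℤ)) • Dop t (phi K (Icc a (a + L))) =
      ∑ j ∈ range (L + 1), (-t) ^ j • phi K ((Icc a (a + L)).erase (a + j)) := by
    rw [Dop_phi, smul_sum]
    conv_lhs => rw [sum_congr hIcc (fun _ _ => rfl)]
    rw [sum_map]
    refine sum_congr rfl fun j hj => ?_
    rw [addLeftEmbedding_apply, hsgn j hj, smul_smul]
    congr 1
    have : t ^ (1 - (a : ℤ)) * t ^ (a + j - 1) = t ^ j := by
      rw [← zpow_natCast, ← zpow_natCast, ← zpow_add₀ ht0]
      congr 1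
      omega
    rw [neg_pow t, ← this]
    ring
  rw [hD, sum_range_succ', chainVec]
  simp only [qint, pow_one, range_one, sum_singleton, pow_zero, div_one, add_zero, one_smul]
  rw [smul_sum, sub_eq_add_neg, add_comm, ← sum_neg_distrib]
  congr 1
  refine sum_congr rfl fun j _ => ?_
  rw [smul_smul, ← neg_smul, add_assoc a 1 j, add_comm 1 j]
  congr 1
  ring

end Operators

/-- With `π_i = φ_{{N−m−1,…,N}∖{i}}`, the product
`(T_{N−m−1} − t)(T_{N−m} − κ_2)⋯(T_{N−1} − κ_{m+1})` (rightmost factor acting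
first) sends `π_N` to `t^{m−N+2}·D(φ_{{N−m−1,…,N}})`; consequently it
annihilates `D(π_N)`. -/
theorem type0_product_formula {K : Type*} [Field K] (t : K) (N m : ℕ)
    (hN : 2 ≤ N) (hm : m ≤ N - 2) (ht0 : t ≠ 0)
    (hreg : ∀ n : ℕ, 1 ≤ n → n ≤ m + 1 → qint t n ≠ 0) :
    (((Tgen t (N - m - 1) - t • 1) *
        ((List.range m).map fun j =>
          (Tgen t (N - m + j) : Module.End K (Finset ℕ →₀ K))
            - kappa t ((j : ℤ) + 2) • 1).prod)
        (phi K ((Finset.Icc (N - m - 1) N).erase N))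
      = (t ^ ((m : ℤ) - N + 2)) • Dop t (phi K (Finset.Icc (N - m - 1) N))) ∧
    (((Tgen t (N - m - 1) - t • 1) *
        ((List.range m).map fun j =>
          (Tgen t (N - m + j) : Module.End K (Finset ℕ →₀ K))
            - kappa t ((j : ℤ) + 2) • 1).prod)
        (Dop t (phi K ((Finset.Icc (N - m - 1) N).erase N))) = 0) := by
  obtain ⟨a, ha, rfl⟩ : ∃ a, 1 ≤ a ∧ N = a + (m + 1) := ⟨N - m - 1, by omega, by omega⟩
  have e1 : a + (m + 1) - m = a + 1 := by omega
  have e2 : a + 1 - 1 = a := by omega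
  have e3 : ((m : ℤ) - ((a + (m + 1) : ℕ) : ℤ) + 2) = 1 - a := by push_cast; ring
  rw [e1, e2, e3]
  have hprod := prod_Tgen_sub_kappa_chainVec t (a := a) (N := a + (m + 1)) (k := m) (L := 0)
    (by omega) hreg (Or.inr rfl)
  have hinit : chainVec t (Icc a (a + (m + 1))) (a + 1 + m) 0 (m + 2) =
      phi K ((Icc a (a + (m + 1))).erase (a + (m + 1))) := by
    simp [chainVec, add_assoc, add_comm 1 m]
  have hkappa : kappa t ((1 : ℕ) : ℤ) = t := by simp [kappa, qint]
  have hlast := Tgen_sub_kappa_chainVec t (A := Icc a (a + (m + 1))) (c := a) (L := m) (n := 1)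
    (by simp) (by simp) one_pos (hreg 1 le_rfl (by omega)) (by
      rcases Nat.eq_zero_or_pos m with h | h
      · exact Or.inr h
      · exact Or.inl (hreg 2 (by omega) (by omega)))
  rw [hkappa, chainVec_one_eq t ht0 ha] at hlast
  rw [hinit, zero_add] at hprod
  set Q := ((List.range m).map fun j =>
    (Tgen t (a + 1 + j) : Module.End K (Finset ℕ →₀ K)) - kappa t ((j : ℤ) + 2) • 1).prod
  have hformula : ((Tgen t a - t • 1 : Module.End K (Finset ℕ →₀ K)) * Q)
      (phi K ((Icc a (a + (m + 1))).erase (a + (m + 1)))) =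
      t ^ (1 - (a : ℤ)) • Dop t (phi K (Icc a (a + (m + 1)))) := by
    rw [Module.End.mul_apply, hprod]
    exact hlast
  have hfactor : ∀ (i : ℕ) (c : K), 1 ≤ i →
      Commute (Dop t) ((Tgen t i : Module.End K (Finset ℕ →₀ K)) - c • 1) := fun i c hi =>
    Commute.sub_right (R := Module.End K (Finset ℕ →₀ K)) (commute_Tgen_Dop t hi).symm
      ((Commute.one_right _).smul_right c)
  have hcomm : Commute (Dop t) ((Tgen t a - t • 1 : Module.End K (Finset ℕ →₀ K)) * Q) := by
    refine (hfactor a t ha).mul_right (Commute.list_prod_right _ _ fun x hx => ?_)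
    obtain ⟨j, _, rfl⟩ := List.mem_map.1 hx
    exact hfactor _ _ (by omega)
  refine ⟨hformula, ?_⟩
  refine (LinearMap.congr_fun hcomm.eq _).symm.trans ?_
  change Dop t (((Tgen t a - t • 1 : Module.End K (Finset ℕ →₀ K)) * Q) _) = 0
  rw [hformula, map_smul, Dop_Dop_phi, smul_zero]
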